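/- Fix α, β ∈ (0, ∞). Let X_n be the number of nonempty boxes on the second main diagonal of a random α/β-staircase tableau of size n. Then X_n converges in distribution to a Poisson random variable with parameter 1: for every integer k ≥ 0, ℙ_{n,α,β}(X_n = k) → e^{−1} / k! as n → ∞. -/

import Mathlib

open scoped BigOperators

/-- A symbol in an α/β-staircase tableau: empty, α, or β. -/
inductive StairSymb : Type
  | empty : StairSymb
  | alpha : StairSymb
  | beta  : StairSymb
  deriving DecidableEq

/-- `S` is an α/β-staircase tableau of size `n` (1-based indexing; boxes are the
pairs `(i,j)` with `1 ≤ i`, `1 ≤ j`, `i + j ≤ n + 1`; outside the boxes `S` is empty). -/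
def IsStaircase (n : ℕ) (S : ℕ → ℕ → StairSymb) : Prop :=
  (∀ i j, ¬(1 ≤ i ∧ 1 ≤ j ∧ i + j ≤ n + 1) → S i j = StairSymb.empty) ∧
  (∀ i i' j, 1 ≤ i → i < i' → 1 ≤ j → i' + j ≤ n + 1 →
    S i' j = StairSymb.alpha → S i j = StairSymb.empty) ∧
  (∀ i j j', 1 ≤ i → 1 ≤ j → j < j' → i + j' ≤ n + 1 →
    S i j' = StairSymb.beta → S i j = StairSymb.empty) ∧
  (∀ i j, 1 ≤ i → 1 ≤ j → i + j = n + 1 → S i j ≠ StairSymb.empty)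

/-- The weight `wt(S) = α^{N_α(S)} β^{N_β(S)}` of a tableau. -/
noncomputable def stairWt (α β : ℝ) (S : ℕ → ℕ → StairSymb) : ℝ :=
  α ^ Set.ncard {p : ℕ × ℕ | S p.1 p.2 = StairSymb.alpha} *
  β ^ Set.ncard {p : ℕ × ℕ | S p.1 p.2 = StairSymb.beta}

/-- The partition function `Z_n(α,β)`, the total weight of all tableaux of size `n`. -/
noncomputable def stairZ (n : ℕ) (α β : ℝ) : ℝ :=
  ∑ᶠ S ∈ {S : ℕ → ℕ → StairSymb | IsStaircase n S}, stairWt α β S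

/-- The probability `ℙ_{n,α,β}(E)` of an event `E` (a set of tableaux of size `n`). -/
noncomputable def stairP (n : ℕ) (α β : ℝ) (E : (ℕ → ℕ → StairSymb) → Prop) : ℝ :=
  (∑ᶠ S ∈ {S : ℕ → ℕ → StairSymb | IsStaircase n S ∧ E S}, stairWt α β S) / stairZ n α β

/-- The expectation `E_{n,α,β}[f]` of a real function of the random tableau. -/
noncomputable def stairE (n : ℕ) (α β : ℝ) (f : (ℕ → ℕ → StairSymb) → ℝ) : ℝ :=
  (∑ᶠ S ∈ {S : ℕ → ℕ → StairSymb | IsStaircase n S}, f S * stairWt α β S) / stairZ n α β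

instance : Finite StairSymb :=
  Finite.of_surjective (fun i : Fin 3 => match i with
    | 0 => StairSymb.empty | 1 => StairSymb.alpha | 2 => StairSymb.beta)
    (fun s => by cases s; exacts [⟨0, rfl⟩, ⟨1, rfl⟩, ⟨2, rfl⟩])

/-- The number of nonempty boxes on the second main diagonal. -/
def stairX (n : ℕ) (S : ℕ → ℕ → StairSymb) : ℕ :=
  ((Finset.Icc 1 (n - 1)).filter (fun j => S (n - j) j ≠ StairSymb.empty)).card

open Classical in
/-- The rows of a tableau of size `n` that contain no `β`. -/
noncomputable def stairFree (n : ℕ) (S : ℕ → ℕ → StairSymb) : Finset ℕ :=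
  (Finset.Icc 1 n).filter (fun i => ∀ j, S i j ≠ StairSymb.beta)

/-- The array obtained from `S` by inserting the column `c` on the left. -/
def stairCons (c : ℕ → StairSymb) (S : ℕ → ℕ → StairSymb) : ℕ → ℕ → StairSymb
  | _, 0 => StairSymb.empty
  | i, 1 => c i
  | i, j + 2 => S i (j + 1)

/-- The columns supported in `F` in which every box above an `α` is empty. -/
def stairCol (F : Finset ℕ) : Set (ℕ → StairSymb) :=
  {c | (∀ i, c i ≠ StairSymb.empty → i ∈ F) ∧
    ∀ i i', i < i' → c i' = StairSymb.alpha → c i = StairSymb.empty}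

/-- The column whose only nonempty box is an `α` in row `a`. -/
def alphaCol (a : ℕ) : ℕ → StairSymb :=
  Function.update (fun _ => StairSymb.empty) a StairSymb.alpha

/-- The column obtained from `c` by putting a `β` in row `a`. -/
def betaCol (a : ℕ) (c : ℕ → StairSymb) : ℕ → StairSymb :=
  Function.update c a StairSymb.beta

/-- The columns that can be inserted on the left of a tableau `S` of size `n`. -/
def stairNewCol (n : ℕ) (S : ℕ → ℕ → StairSymb) : Set (ℕ → StairSymb) :=
  insert (alphaCol (n + 1)) (betaCol (n + 1) '' stairCol (stairFree n S))

lemma stairCol_finite (F : Finset ℕ) : (stairCol F).Finite := by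
  refine Set.Finite.of_finite_image (f := fun c (i : F) => c i) (Set.toFinite _) ?_
  intro c hc d hd h
  funext i
  by_cases hi : i ∈ F
  · exact congrFun h ⟨i, hi⟩
  · have h1 : c i = StairSymb.empty := by_contra fun h => hi (hc.1 i h)
    have h2 : d i = StairSymb.empty := by_contra fun h => hi (hd.1 i h)
    rw [h1, h2]

lemma stairCol_apply_eq_empty {F : Finset ℕ} {c : ℕ → StairSymb} (hc : c ∈ stairCol F) {i : ℕ}
    (hi : i ∉ F) : c i = StairSymb.empty :=
  by_contra fun h => hi (hc.1 i h)

lemma betaCol_injOn {F : Finset ℕ} {a : ℕ} (ha : a ∉ F) :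
    Set.InjOn (betaCol a) (stairCol F) := by
  intro c hc d hd h
  funext i
  by_cases hi : i = a
  · subst hi
    rw [stairCol_apply_eq_empty hc ha, stairCol_apply_eq_empty hd ha]
  · simpa [betaCol, hi] using congrFun h i

lemma update_empty_mem_stairCol {F : Finset ℕ} {a : ℕ} {c : ℕ → StairSymb}
    (hc : c ∈ stairCol (insert a F)) :
    Function.update c a StairSymb.empty ∈ stairCol F := by
  refine ⟨fun i hi => ?_, fun i i' h h' => ?_⟩
  · by_cases hia : i = a
    · simp [hia] at hi
    · rw [Function.update_of_ne hia] at hi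
      exact Finset.mem_of_mem_insert_of_ne (hc.1 i hi) hia
  · have hia : i' ≠ a := by rintro rfl; simp at h'
    rw [Function.update_of_ne hia] at h'
    by_cases hi : i = a
    · simp [hi]
    · rw [Function.update_of_ne hi]
      exact hc.2 i i' h h'

lemma betaCol_mem_stairCol {F : Finset ℕ} {a : ℕ} (ha : ∀ i ∈ F, i < a) {c : ℕ → StairSymb}
    (hc : c ∈ stairCol F) : betaCol a c ∈ stairCol (insert a F) := by
  refine ⟨fun i hi => ?_, fun i i' h h' => ?_⟩
  · by_cases hia : i = a
    · simp [hia]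
    · rw [betaCol, Function.update_of_ne hia] at hi
      exact Finset.mem_insert_of_mem (hc.1 i hi)
  · have hia : i' ≠ a := by rintro rfl; simp [betaCol] at h'
    rw [betaCol, Function.update_of_ne hia] at h'
    have := ha i' (hc.1 i' (by simp [h']))
    rw [betaCol, Function.update_of_ne (by omega)]
    exact hc.2 i i' h h'

lemma alphaCol_mem_stairCol {F : Finset ℕ} {a : ℕ} : alphaCol a ∈ stairCol (insert a F) := by
  refine ⟨fun i hi => ?_, fun i i' h h' => ?_⟩
  · by_cases hia : i = a
    · simp [hia]
    · simp [alphaCol, hia] at hi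
  · have hia : i' = a := by
      by_contra hia
      simp [alphaCol, hia] at h'
    rw [alphaCol, Function.update_of_ne (by omega)]

lemma eq_alphaCol {F : Finset ℕ} {a : ℕ} (ha : ∀ i ∈ F, i < a) {c : ℕ → StairSymb}
    (hc : c ∈ stairCol (insert a F)) (h : c a = StairSymb.alpha) : c = alphaCol a := by
  funext i
  by_cases hi : i = a
  · simp [hi, h, alphaCol]
  · rw [alphaCol, Function.update_of_ne hi]
    by_contra hne
    have := ha i (Finset.mem_of_mem_insert_of_ne (hc.1 i hne) hi)
    exact hne (hc.2 i a this h)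

lemma eq_betaCol {a : ℕ} {c : ℕ → StairSymb} (h : c a = StairSymb.beta) :
    c = betaCol a (Function.update c a StairSymb.empty) := by
  rw [betaCol, Function.update_idem, ← h, Function.update_eq_self]

lemma stairCol_insert {F : Finset ℕ} {a : ℕ} (ha : ∀ i ∈ F, i < a) :
    stairCol (insert a F) =
      insert (alphaCol a) (stairCol F ∪ betaCol a '' stairCol F) := by
  ext c
  constructor
  · intro hc
    have hu := update_empty_mem_stairCol hc
    cases h : c a with
    | empty =>
      right; left
      rwa [← h, Function.update_eq_self] at hu
    | alpha => left; exact eq_alphaCol ha hc h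
    | beta => right; right; exact ⟨_, hu, (eq_betaCol h).symm⟩
  · rintro (rfl | hc | ⟨c, hc, rfl⟩)
    · exact alphaCol_mem_stairCol
    · exact ⟨fun i hi => Finset.mem_insert_of_mem (hc.1 i hi), hc.2⟩
    · exact betaCol_mem_stairCol ha hc

lemma finsum_stairCol_insert {F : Finset ℕ} {a : ℕ} (ha : ∀ i ∈ F, i < a)
    (f : (ℕ → StairSymb) → ℝ) :
    ∑ᶠ c ∈ stairCol (insert a F), f c =
      f (alphaCol a) + (∑ᶠ c ∈ stairCol F, f c + ∑ᶠ c ∈ stairCol F, f (betaCol a c)) := by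
  have haF : a ∉ F := fun h => lt_irrefl a (ha a h)
  have hemp : ∀ c ∈ stairCol F, c a = StairSymb.empty := fun c hc =>
    stairCol_apply_eq_empty hc haF
  rw [stairCol_insert ha, finsum_mem_insert, finsum_mem_union, finsum_mem_image]
  · exact betaCol_injOn haF
  · rw [Set.disjoint_left]
    rintro c hc ⟨d, -, rfl⟩
    simpa [betaCol] using hemp _ hc
  · exact stairCol_finite F
  · exact (stairCol_finite F).image _
  · rintro (h | ⟨d, -, h⟩)
    · simpa [alphaCol] using hemp _ h
    · simpa [alphaCol, betaCol] using congrFun h a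
  · exact (stairCol_finite F).union ((stairCol_finite F).image _)

lemma stairNewCol_finite (n : ℕ) (S : ℕ → ℕ → StairSymb) : (stairNewCol n S).Finite :=
  ((stairCol_finite _).image _).insert _

lemma lt_of_mem_stairFree {n : ℕ} {S : ℕ → ℕ → StairSymb} {i : ℕ} (hi : i ∈ stairFree n S) :
    i < n + 1 := by
  simp only [stairFree, Finset.mem_filter, Finset.mem_Icc] at hi
  omega

lemma mem_stairNewCol {n : ℕ} {S : ℕ → ℕ → StairSymb} {c : ℕ → StairSymb} :
    c ∈ stairNewCol n S ↔
      c ∈ stairCol (insert (n + 1) (stairFree n S)) ∧ c (n + 1) ≠ StairSymb.empty := by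
  have ha : ∀ i ∈ stairFree n S, i < n + 1 := fun i => lt_of_mem_stairFree
  constructor
  · rintro (rfl | ⟨c, hc, rfl⟩)
    · exact ⟨alphaCol_mem_stairCol, by simp [alphaCol]⟩
    · exact ⟨betaCol_mem_stairCol ha hc, by simp [betaCol]⟩
  · rintro ⟨hc, h0⟩
    cases h : c (n + 1) with
    | empty => exact absurd h h0
    | alpha => left; exact eq_alphaCol ha hc h
    | beta => right; exact ⟨_, update_empty_mem_stairCol hc, (eq_betaCol h).symm⟩

lemma finsum_stairNewCol (n : ℕ) (S : ℕ → ℕ → StairSymb) (f : (ℕ → StairSymb) → ℝ) :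
    ∑ᶠ c ∈ stairNewCol n S, f c =
      f (alphaCol (n + 1)) + ∑ᶠ c ∈ stairCol (stairFree n S), f (betaCol (n + 1) c) := by
  rw [stairNewCol, finsum_mem_insert, finsum_mem_image]
  · exact betaCol_injOn fun h => lt_irrefl _ (lt_of_mem_stairFree h)
  · rintro ⟨d, -, h⟩
    simpa [alphaCol, betaCol] using congrFun h (n + 1)
  · exact (stairCol_finite _).image _

lemma isStaircase_stairCons {n : ℕ} {S : ℕ → ℕ → StairSymb} {c : ℕ → StairSymb}
    (hS : IsStaircase n S) (hc : c ∈ stairNewCol n S) : IsStaircase (n + 1) (stairCons c S) := by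
  rw [mem_stairNewCol] at hc
  obtain ⟨⟨hc1, hc2⟩, hc3⟩ := hc
  obtain ⟨h1, h2, h3, h4⟩ := hS
  refine ⟨?_, ?_, ?_, ?_⟩
  · rintro i (_ | _ | j) h
    · rfl
    · by_contra hne
      have := hc1 i hne
      simp only [Finset.mem_insert, stairFree, Finset.mem_filter, Finset.mem_Icc] at this
      omega
    · exact h1 i (j + 1) (by omega)
  · rintro i i' (_ | _ | j) hi hii hj hs
    · omega
    · exact hc2 i i' hii
    · exact h2 i i' (j + 1) hi hii (by omega) (by omega)
  · rintro i (_ | _ | j) (_ | _ | j') hi hj hjj hs hb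
    any_goals omega
    · by_contra hne
      have := hc1 i hne
      simp only [Finset.mem_insert, stairFree, Finset.mem_filter, Finset.mem_Icc] at this
      rcases this with h | ⟨-, h⟩
      · omega
      · exact h _ hb
    · exact h3 i (j + 1) (j' + 1) hi (by omega) (by omega) (by omega) hb
  · rintro i (_ | _ | j) hi hj hs
    · omega
    · have : i = n + 1 := by omega
      subst this
      exact hc3
    · exact h4 i (j + 1) hi (by omega) (by omega)

lemma exists_stairCons {n : ℕ} {S : ℕ → ℕ → StairSymb} (hS : IsStaircase (n + 1) S) :
    ∃ S', IsStaircase n S' ∧ ∃ c ∈ stairNewCol n S', stairCons c S' = S := by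
  obtain ⟨h1, h2, h3, h4⟩ := hS
  refine ⟨fun i j => if j = 0 then StairSymb.empty else S i (j + 1), ⟨?_, ?_, ?_, ?_⟩,
    fun i => S i 1, ?_, ?_⟩
  · intro i j h
    by_cases hj : j = 0
    · simp [hj]
    · simpa [hj] using h1 i (j + 1) (by omega)
  · intro i i' j hi hii hj hs h
    have hj0 : j ≠ 0 := by omega
    simp only [hj0, if_false] at h ⊢
    exact h2 i i' (j + 1) hi hii (by omega) (by omega) h
  · intro i j j' hi hj hjj hs h
    have hj0 : j ≠ 0 := by omega
    have hj0' : j' ≠ 0 := by omega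
    simp only [hj0, hj0', if_false] at h ⊢
    exact h3 i (j + 1) (j' + 1) hi (by omega) (by omega) (by omega) h
  · intro i j hi hj hs
    have hj0 : j ≠ 0 := by omega
    simp only [hj0, if_false]
    exact h4 i (j + 1) hi (by omega) (by omega)
  · rw [mem_stairNewCol]
    have hr : ∀ i, S i 1 ≠ StairSymb.empty → 1 ≤ i ∧ i ≤ n + 1 := fun i hi => by
      by_contra h
      exact hi (h1 i 1 (by omega))
    refine ⟨⟨fun i hi => ?_, fun i i' hii h => ?_⟩, h4 (n + 1) 1 (by omega) le_rfl rfl⟩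
    · obtain ⟨hi1, hi2⟩ := hr i hi
      rw [Finset.mem_insert]
      by_cases hin : i = n + 1
      · exact Or.inl hin
      · right
        simp only [stairFree, Finset.mem_filter, Finset.mem_Icc]
        refine ⟨by omega, fun j hj => ?_⟩
        by_cases hj0 : j = 0
        · simp [hj0] at hj
        · simp only [hj0, if_false] at hj
          by_cases hs : i + (j + 1) ≤ n + 1 + 1
          · exact hi (h3 i 1 (j + 1) hi1 le_rfl (by omega) hs hj)
          · rw [h1 i (j + 1) (by omega)] at hj
            cases hj
    · by_cases hi : 1 ≤ i
      · exact h2 i i' 1 hi hii le_rfl (by have := hr i' (by simp [h]); omega) h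
      · exact h1 i 1 (by omega)
  · funext i j
    rcases j with _ | _ | j
    · exact (h1 i 0 (by omega)).symm
    · rfl
    · simp [stairCons]

lemma stairCons_injective {n : ℕ} {S S' : ℕ → ℕ → StairSymb} {c c' : ℕ → StairSymb}
    (hS : IsStaircase n S) (hS' : IsStaircase n S') (h : stairCons c S = stairCons c' S') :
    c = c' ∧ S = S' := by
  refine ⟨funext fun i => congrFun (congrFun h i) 1, funext fun i => funext fun j => ?_⟩
  rcases j with _ | j
  · rw [hS.1 i 0 (by omega), hS'.1 i 0 (by omega)]
  · exact congrFun (congrFun h i) (j + 2)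

lemma setOf_isStaircase_succ (n : ℕ) :
    {S | IsStaircase (n + 1) S} =
      ⋃ S ∈ {S | IsStaircase n S}, (fun c => stairCons c S) '' stairNewCol n S := by
  ext S
  simp only [Set.mem_ofPred_eq, Set.mem_iUnion, Set.mem_image, exists_prop]
  constructor
  · exact exists_stairCons
  · rintro ⟨S', hS', c, hc, rfl⟩
    exact isStaircase_stairCons hS' hc

lemma setOf_isStaircase_zero :
    {S | IsStaircase 0 S} = {fun _ _ => StairSymb.empty} := by
  ext S
  simp only [Set.mem_ofPred_eq, Set.mem_singleton_iff]
  constructor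
  · intro h
    funext i j
    exact h.1 i j (by omega)
  · rintro rfl
    refine ⟨fun _ _ _ => rfl, fun _ _ _ _ _ _ _ _ => rfl, fun _ _ _ _ _ _ _ _ => rfl, ?_⟩
    intro i j hi hj h
    omega

lemma finite_isStaircase (n : ℕ) : {S | IsStaircase n S}.Finite := by
  induction n with
  | zero => rw [setOf_isStaircase_zero]; exact Set.finite_singleton _
  | succ n ih =>
    rw [setOf_isStaircase_succ]
    exact ih.biUnion fun S _ => (stairNewCol_finite n S).image _

lemma finsum_isStaircase_succ (n : ℕ) (f : (ℕ → ℕ → StairSymb) → ℝ) :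
    ∑ᶠ S ∈ {S | IsStaircase (n + 1) S}, f S =
      ∑ᶠ S ∈ {S | IsStaircase n S}, (f (stairCons (alphaCol (n + 1)) S) +
        ∑ᶠ c ∈ stairCol (stairFree n S), f (stairCons (betaCol (n + 1) c) S)) := by
  rw [setOf_isStaircase_succ, finsum_mem_biUnion]
  · refine finsum_mem_congr rfl fun S hS => ?_
    rw [finsum_mem_image, finsum_stairNewCol]
    exact fun c _ d _ h => (stairCons_injective hS hS h).1
  · intro S hS S' hS' hne
    rw [Function.onFun, Set.disjoint_left]
    rintro _ ⟨c, -, rfl⟩ ⟨d, -, h⟩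
    exact hne (stairCons_injective hS' hS h).2.symm
  · exact finite_isStaircase n
  · exact fun S _ => (stairNewCol_finite n S).image _

/-- The weight of a symbol, where every symbol other than `β` carries an extra factor `x`. -/
def symbWt (α β x : ℝ) : StairSymb → ℝ
  | StairSymb.empty => x
  | StairSymb.alpha => α * x
  | StairSymb.beta => β

lemma prod_symbWt (α β x : ℝ) (F : Finset ℕ) (c : ℕ → StairSymb) :
    ∏ i ∈ F, symbWt α β x (c i) =
      α ^ (F.filter (fun i => c i = StairSymb.alpha)).card *
        β ^ (F.filter (fun i => c i = StairSymb.beta)).card *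
        x ^ (F.filter (fun i => c i ≠ StairSymb.beta)).card := by
  induction F using Finset.induction_on with
  | empty => simp
  | insert a F ha ih =>
    rw [Finset.prod_insert ha, ih]
    cases h : c a <;>
      simp [Finset.filter_insert, h, symbWt, ha, pow_succ] <;> ring

lemma finite_ne_empty {n : ℕ} {S : ℕ → ℕ → StairSymb} (hS : IsStaircase n S) :
    {p : ℕ × ℕ | S p.1 p.2 ≠ StairSymb.empty}.Finite := by
  refine ((Finset.range (n + 1)) ×ˢ (Finset.range (n + 1))).finite_toSet.subset ?_
  rintro ⟨i, j⟩ h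
  have : 1 ≤ i ∧ 1 ≤ j ∧ i + j ≤ n + 1 := by
    by_contra hn
    exact h (hS.1 i j hn)
  simp only [Finset.coe_product, Set.mem_prod, Finset.mem_coe, Finset.mem_range]
  omega

lemma ncard_stairCons {n : ℕ} {S : ℕ → ℕ → StairSymb} (hS : IsStaircase n S) {G : Finset ℕ}
    {c : ℕ → StairSymb} (hc : ∀ i, c i ≠ StairSymb.empty → i ∈ G) {s : StairSymb}
    (hs : s ≠ StairSymb.empty) :
    {p : ℕ × ℕ | stairCons c S p.1 p.2 = s}.ncard =
      {p : ℕ × ℕ | S p.1 p.2 = s}.ncard + (G.filter (fun i => c i = s)).card := by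
  have hfin : {p : ℕ × ℕ | S p.1 p.2 = s}.Finite :=
    (finite_ne_empty hS).subset fun p (hp : S p.1 p.2 = s) => by
      change S p.1 p.2 ≠ _
      rwa [hp]
  have hset : {p : ℕ × ℕ | stairCons c S p.1 p.2 = s} =
      (fun p : ℕ × ℕ => (p.1, p.2 + 1)) '' {p : ℕ × ℕ | S p.1 p.2 = s} ∪
        (fun i : ℕ => (i, 1)) '' (G.filter (fun i => c i = s) : Set ℕ) := by
    ext ⟨i, j⟩
    simp only [Set.mem_ofPred_eq, Set.mem_union, Set.mem_image, Finset.coe_filter, Prod.exists,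
      Prod.mk.injEq]
    rcases j with _ | _ | j
    · simpa [stairCons] using hs.symm
    · have h0 : S i 0 ≠ s := by rw [hS.1 i 0 (by omega)]; exact hs.symm
      simp only [stairCons, zero_add, Nat.add_eq_right, exists_eq_right_right, and_true,
        exists_eq_right]
      constructor
      · intro h
        exact Or.inr ⟨hc i (by rwa [h]), h⟩
      · rintro (h | h)
        · exact absurd (by grind) h0
        · exact h.2
    · simp only [stairCons]
      constructor
      · intro h
        exact Or.inl ⟨i, j + 1, h, rfl, rfl⟩
      · rintro (⟨i', j', h, rfl, h'⟩ | ⟨i', -, -, h'⟩)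
        · have : j' = j + 1 := by omega
          rwa [← this]
        · omega
  rw [hset, Set.ncard_union_eq ?_ (hfin.image _) ((Finset.finite_toSet _).image _),
    Set.ncard_image_of_injective, Set.ncard_image_of_injective,
    Set.ncard_coe_finset]
  · intro i i' h
    simpa using h
  · rintro ⟨i, j⟩ ⟨i', j'⟩ h
    simpa using h
  · rw [Set.disjoint_left]
    rintro _ ⟨⟨i, j⟩, h, rfl⟩ ⟨i', -, h'⟩
    have hj : j = 0 := by simpa [eq_comm] using congrArg Prod.snd h'
    subst hj
    exact hs ((show S i 0 = s from h).symm.trans (hS.1 i 0 (by omega)))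

lemma stairWt_stairCons (α β : ℝ) {n : ℕ} {S : ℕ → ℕ → StairSymb} (hS : IsStaircase n S)
    {G : Finset ℕ} {c : ℕ → StairSymb} (hc : ∀ i, c i ≠ StairSymb.empty → i ∈ G) :
    stairWt α β (stairCons c S) = stairWt α β S * ∏ i ∈ G, symbWt α β 1 (c i) := by
  rw [prod_symbWt, stairWt, stairWt, ncard_stairCons hS hc (by simp),
    ncard_stairCons hS hc (by simp), pow_add, pow_add]
  ring

lemma stairFree_stairCons {n : ℕ} {S : ℕ → ℕ → StairSymb} (hS : IsStaircase n S)
    (c : ℕ → StairSymb) :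
    stairFree (n + 1) (stairCons c S) =
      (insert (n + 1) (stairFree n S)).filter (fun i => c i ≠ StairSymb.beta) := by
  ext i
  simp only [stairFree, Finset.mem_filter, Finset.mem_insert, Finset.mem_Icc]
  constructor
  · rintro ⟨hi, h⟩
    refine ⟨?_, h 1⟩
    by_cases hin : i = n + 1
    · exact Or.inl hin
    · refine Or.inr ⟨by omega, fun j => ?_⟩
      rcases j with _ | j
      · simp [hS.1 i 0 (by omega)]
      · exact h (j + 2)
  · rintro ⟨hi, h⟩
    refine ⟨by omega, fun j => ?_⟩
    rcases j with _ | _ | j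
    · simp [stairCons]
    · exact h
    · rcases hi with rfl | hi
      · simp [stairCons, hS.1 (n + 1) (j + 1) (by omega)]
      · exact hi.2 _

lemma stairX_stairCons {n : ℕ} {S : ℕ → ℕ → StairSymb} {c : ℕ → StairSymb}
    (hc : c 0 = StairSymb.empty) :
    stairX (n + 1) (stairCons c S) =
      stairX n S + if c n = StairSymb.empty then 0 else 1 := by
  have key : ∀ (m : ℕ) (p : ℕ → Prop) [DecidablePred p],
      ((Finset.Icc 1 m).filter p).card = ∑ i ∈ Finset.range m, if p (i + 1) then 1 else 0 := by
    intro m p _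
    rw [Finset.card_filter, Finset.range_eq_Ico, Finset.sum_Ico_add' (fun i => if p i then 1 else 0)]
    rfl
  unfold stairX
  rw [key, key]
  rcases n with _ | n
  · simp [hc]
  · simp only [Nat.add_sub_cancel]
    rw [Finset.sum_range_succ']
    congr 1
    · refine Finset.sum_congr rfl fun i _ => ?_
      have : n + 1 + 1 - (i + 1 + 1) = n + 1 - (i + 1) := by omega
      rw [this]
      rfl
    · simp [stairCons]

lemma stairCons_alphaCol (α β : ℝ) {n : ℕ} {S : ℕ → ℕ → StairSymb}
    (hS : IsStaircase n S) :
    stairWt α β (stairCons (alphaCol (n + 1)) S) = stairWt α β S * α ∧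
      stairFree (n + 1) (stairCons (alphaCol (n + 1)) S) = insert (n + 1) (stairFree n S) ∧
      stairX (n + 1) (stairCons (alphaCol (n + 1)) S) = stairX n S := by
  refine ⟨?_, ?_, ?_⟩
  · rw [stairWt_stairCons α β hS (G := {n + 1})]
    · simp [alphaCol, symbWt]
    · intro i hi
      by_contra hne
      rw [Finset.mem_singleton] at hne
      simp [alphaCol, hne] at hi
  · rw [stairFree_stairCons hS, Finset.filter_true_of_mem]
    intro i _
    by_cases hi : i = n + 1 <;> simp [alphaCol, hi]
  · rw [stairX_stairCons (by simp [alphaCol])]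
    simp [alphaCol]

lemma stairCons_betaCol (α β x : ℝ) {n : ℕ} {S : ℕ → ℕ → StairSymb}
    (hS : IsStaircase n S) {c : ℕ → StairSymb} (hc : c ∈ stairCol (stairFree n S)) :
    stairWt α β (stairCons (betaCol (n + 1) c) S) *
        x ^ (stairFree (n + 1) (stairCons (betaCol (n + 1) c) S)).card =
      stairWt α β S * β * ∏ i ∈ stairFree n S, symbWt α β x (c i) ∧
      n + 1 ∉ stairFree (n + 1) (stairCons (betaCol (n + 1) c) S) ∧
      stairX (n + 1) (stairCons (betaCol (n + 1) c) S) =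
        stairX n S + if c n = StairSymb.empty then 0 else 1 := by
  have hlt : ∀ i ∈ stairFree n S, i < n + 1 := fun i => lt_of_mem_stairFree
  have hn : n + 1 ∉ stairFree n S := fun h => lt_irrefl _ (hlt _ h)
  have hb : ∀ i ∈ stairFree n S, betaCol (n + 1) c i = c i := fun i hi => by
    rw [betaCol, Function.update_of_ne (hlt i hi).ne]
  have hb' : betaCol (n + 1) c (n + 1) = StairSymb.beta := by simp [betaCol]
  have hfree : stairFree (n + 1) (stairCons (betaCol (n + 1) c) S) =
      (stairFree n S).filter (fun i => c i ≠ StairSymb.beta) := by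
    rw [stairFree_stairCons hS, Finset.filter_insert, if_neg (by simp [hb'])]
    exact Finset.filter_congr fun i hi => by rw [hb i hi]
  refine ⟨?_, ?_, ?_⟩
  · rw [stairWt_stairCons α β hS (betaCol_mem_stairCol hlt hc).1, hfree,
      Finset.prod_insert hn, hb', Finset.prod_congr rfl fun i hi => by rw [hb i hi],
      prod_symbWt, prod_symbWt]
    simp only [symbWt, one_pow]
    ring
  · rw [hfree]
    exact fun h => hn (Finset.mem_filter.1 h).1
  · rw [stairX_stairCons]
    · simp [betaCol]
    · rw [betaCol, Function.update_of_ne (by omega)]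
      refine stairCol_apply_eq_empty hc ?_
      simp [stairFree]

lemma symbWt_prod_alphaCol (α β x : ℝ) {F : Finset ℕ} {a : ℕ} (ha : a ∉ F) :
    ∏ i ∈ insert a F, symbWt α β x (alphaCol a i) = α * x * x ^ F.card := by
  rw [Finset.prod_insert ha]
  congr 1
  · simp [alphaCol, symbWt]
  · refine Finset.prod_eq_pow_card fun i hi => ?_
    rw [alphaCol, Function.update_of_ne (ne_of_mem_of_not_mem hi ha)]
    rfl

lemma symbWt_prod_betaCol (α β x : ℝ) {F : Finset ℕ} {a : ℕ} (ha : a ∉ F) (c : ℕ → StairSymb) :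
    ∏ i ∈ insert a F, symbWt α β x (betaCol a c i) = β * ∏ i ∈ F, symbWt α β x (c i) := by
  rw [Finset.prod_insert ha]
  congr 1
  · simp [betaCol, symbWt]
  · refine Finset.prod_congr rfl fun i hi => ?_
    rw [betaCol, Function.update_of_ne (ne_of_mem_of_not_mem hi ha)]

lemma symbWt_prod_of_mem_stairCol (α β x : ℝ) {F : Finset ℕ} {a : ℕ} (ha : a ∉ F)
    {c : ℕ → StairSymb} (hc : c ∈ stairCol F) :
    ∏ i ∈ insert a F, symbWt α β x (c i) = x * ∏ i ∈ F, symbWt α β x (c i) := by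
  rw [Finset.prod_insert ha, stairCol_apply_eq_empty hc ha]
  rfl

/-- The weight enumerator of the columns supported in a set of rows. -/
lemma finsum_stairCol (α β x : ℝ) (F : Finset ℕ) :
    β * ∑ᶠ c ∈ stairCol F, ∏ i ∈ F, symbWt α β x (c i) =
      (α * x + β) * (x + β) ^ F.card - α * x * x ^ F.card := by
  induction F using Finset.induction_on_max with
  | empty =>
    have : stairCol ∅ = {fun _ => StairSymb.empty} := by
      ext c
      rw [Set.mem_singleton_iff]
      constructor
      · exact fun hc => funext fun i => stairCol_apply_eq_empty hc (Finset.notMem_empty i)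
      · rintro rfl
        exact ⟨fun i h => absurd rfl h, fun _ _ _ _ => rfl⟩
    simp [this]
  | insert a F ha ih =>
    have haF : a ∉ F := fun h => lt_irrefl a (ha a h)
    rw [finsum_stairCol_insert ha, symbWt_prod_alphaCol α β x haF,
      finsum_mem_congr rfl fun c hc => symbWt_prod_of_mem_stairCol α β x haF hc,
      finsum_mem_congr rfl fun c _ => symbWt_prod_betaCol α β x haF c,
      ← mul_finsum_mem, ← mul_finsum_mem,
      Finset.card_insert_of_notMem haF, ← add_mul]
    linear_combination (x + β) * ih

/-- The weight enumerator of the columns, where a nonempty box in row `n` carries an extra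
factor `t`. -/
lemma finsum_stairCol_mark (α β x t : ℝ) {n : ℕ} {F : Finset ℕ} (hF : ∀ i ∈ F, i ≤ n) :
    α * x * x ^ F.card + β * ∑ᶠ c ∈ stairCol F, (∏ i ∈ F, symbWt α β x (c i)) *
        t ^ (if c n = StairSymb.empty then 0 else 1) =
      (α * x + β) * (x + β) ^ F.card +
        if n ∈ F then (t - 1) * β * (α * x + β) * (x + β) ^ (F.card - 1) else 0 := by
  by_cases hn : n ∈ F
  · obtain ⟨F, hnF, rfl⟩ : ∃ F', n ∉ F' ∧ insert n F' = F :=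
      ⟨F.erase n, Finset.notMem_erase n F, Finset.insert_erase hn⟩
    have ha : ∀ i ∈ F, i < n := fun i hi =>
      lt_of_le_of_ne (hF i (Finset.mem_insert_of_mem hi)) (ne_of_mem_of_not_mem hi hnF)
    have h1 : ∀ c ∈ stairCol F, (∏ i ∈ insert n F, symbWt α β x (c i)) *
        t ^ (if c n = StairSymb.empty then 0 else 1) = x * ∏ i ∈ F, symbWt α β x (c i) := by
      intro c hc
      rw [symbWt_prod_of_mem_stairCol α β x hnF hc, stairCol_apply_eq_empty hc hnF]
      simp
    have h2 : ∀ c ∈ stairCol F, (∏ i ∈ insert n F, symbWt α β x (betaCol n c i)) *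
        t ^ (if betaCol n c n = StairSymb.empty then 0 else 1) =
          (t * β) * ∏ i ∈ F, symbWt α β x (c i) := by
      intro c hc
      rw [symbWt_prod_betaCol α β x hnF c]
      simp [betaCol]
      ring
    have h3 := finsum_stairCol α β x F
    rw [finsum_stairCol_insert ha, symbWt_prod_alphaCol α β x hnF,
      finsum_mem_congr rfl h1, finsum_mem_congr rfl h2,
      ← mul_finsum_mem, ← mul_finsum_mem,
      Finset.card_insert_of_notMem hnF, if_pos (Finset.mem_insert_self n F)]
    have h4 : alphaCol n n ≠ StairSymb.empty := by simp [alphaCol]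
    rw [if_neg h4, Nat.add_sub_cancel]
    linear_combination (x + t * β) * h3
  · have h1 : ∀ c ∈ stairCol F, (∏ i ∈ F, symbWt α β x (c i)) *
        t ^ (if c n = StairSymb.empty then 0 else 1) = ∏ i ∈ F, symbWt α β x (c i) := by
      intro c hc
      rw [stairCol_apply_eq_empty hc hn]
      simp
    rw [finsum_mem_congr rfl h1, finsum_stairCol, if_neg hn]
    ring

/-- The generating function of tableaux of size `n`, where `x` marks rows without `β` and `t`
marks nonempty boxes on the second main diagonal. -/
noncomputable def stairGen (α β t : ℝ) (n : ℕ) (x : ℝ) : ℝ :=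
  ∑ᶠ S ∈ {S | IsStaircase n S}, stairWt α β S * t ^ stairX n S * x ^ (stairFree n S).card

lemma stairGen_zero (α β t x : ℝ) : stairGen α β t 0 x = 1 := by
  simp [stairGen, setOf_isStaircase_zero, stairWt, stairX, stairFree]

lemma stairGen_succ_aux (α β t : ℝ) (n : ℕ) (x : ℝ) :
    stairGen α β t (n + 1) x = (α * x + β) * stairGen α β t n (x + β) +
      (t - 1) * β * (α * x + β) * ∑ᶠ S ∈ {S | IsStaircase n S}, if n ∈ stairFree n S then
        stairWt α β S * t ^ stairX n S * (x + β) ^ ((stairFree n S).card - 1) else 0 := by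
  rw [stairGen, stairGen, finsum_isStaircase_succ, mul_finsum_mem,
    mul_finsum_mem, ← finsum_mem_add_distrib (finite_isStaircase n)]
  refine finsum_mem_congr rfl fun S hS => ?_
  obtain ⟨hw, hf, hX⟩ := stairCons_alphaCol α β hS
  have hn : n + 1 ∉ stairFree n S := fun h => lt_irrefl _ (lt_of_mem_stairFree h)
  have h1 : ∀ c ∈ stairCol (stairFree n S),
      stairWt α β (stairCons (betaCol (n + 1) c) S) *
        t ^ stairX (n + 1) (stairCons (betaCol (n + 1) c) S) *
        x ^ (stairFree (n + 1) (stairCons (betaCol (n + 1) c) S)).card =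
      (stairWt α β S * t ^ stairX n S * β) * ((∏ i ∈ stairFree n S, symbWt α β x (c i)) *
        t ^ (if c n = StairSymb.empty then 0 else 1)) := by
    intro c hc
    obtain ⟨hw', -, hX'⟩ := stairCons_betaCol α β x hS hc
    rw [mul_right_comm, hw', hX', pow_add]
    ring
  have h2 := finsum_stairCol_mark α β x t (F := stairFree n S) (n := n)
    fun i hi => Nat.lt_succ_iff.1 (lt_of_mem_stairFree hi)
  rw [finsum_mem_congr rfl h1, ← mul_finsum_mem, hw, hf, hX,
    Finset.card_insert_of_notMem hn]
  split_ifs at h2 ⊢ <;> linear_combination (stairWt α β S * t ^ stairX n S) * h2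

lemma stairGen_one (α β t x : ℝ) : stairGen α β t 1 x = α * x + β := by
  simp [stairGen_succ_aux, stairGen_zero, stairFree]

lemma stairGen_succ_succ (α β t : ℝ) (n : ℕ) (x : ℝ) :
    stairGen α β t (n + 2) x = (α * x + β) * stairGen α β t (n + 1) (x + β) +
      (t - 1) * (α * β) * ((α * x + β) * stairGen α β t n (x + β)) := by
  rw [stairGen_succ_aux, finsum_isStaircase_succ, add_right_inj]
  have : ∀ S ∈ {S | IsStaircase n S},
      ((if n + 1 ∈ stairFree (n + 1) (stairCons (alphaCol (n + 1)) S) then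
        stairWt α β (stairCons (alphaCol (n + 1)) S) *
          t ^ stairX (n + 1) (stairCons (alphaCol (n + 1)) S) *
          (x + β) ^ ((stairFree (n + 1) (stairCons (alphaCol (n + 1)) S)).card - 1) else 0) +
      ∑ᶠ c ∈ stairCol (stairFree n S),
        if n + 1 ∈ stairFree (n + 1) (stairCons (betaCol (n + 1) c) S) then
        stairWt α β (stairCons (betaCol (n + 1) c) S) *
          t ^ stairX (n + 1) (stairCons (betaCol (n + 1) c) S) *
          (x + β) ^ ((stairFree (n + 1) (stairCons (betaCol (n + 1) c) S)).card - 1) else 0) =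
      α * (stairWt α β S * t ^ stairX n S * (x + β) ^ (stairFree n S).card) := by
    intro S hS
    obtain ⟨hw, hf, hX⟩ := stairCons_alphaCol α β hS
    have hn : n + 1 ∉ stairFree n S := fun h => lt_irrefl _ (lt_of_mem_stairFree h)
    rw [finsum_mem_congr rfl fun c hc =>
      if_neg (stairCons_betaCol α β x hS hc).2.1, finsum_mem_zero, hw, hf, hX,
      Finset.card_insert_of_notMem hn, if_pos (Finset.mem_insert_self _ _), Nat.add_sub_cancel]
    ring
  rw [finsum_mem_congr rfl this, ← mul_finsum_mem, ← stairGen]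
  ring

/-- The generating function of tableaux of size `m` by the number of rows without `β`. -/
noncomputable def stairProd (α β : ℝ) (m : ℕ) (x : ℝ) : ℝ :=
  ∏ i ∈ Finset.range m, (α * x + β + i * (α * β))

lemma stairProd_succ (α β : ℝ) (m : ℕ) (x : ℝ) :
    stairProd α β (m + 1) x = (α * x + β) * stairProd α β m (x + β) := by
  rw [stairProd, stairProd, Finset.prod_range_succ', mul_comm]
  congr 1
  · simp
  · refine Finset.prod_congr rfl fun i _ => ?_
    push_cast
    ring

lemma stairGen_eq (α β t : ℝ) (n : ℕ) (x : ℝ) :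
    stairGen α β t n x = ∑ p ∈ Finset.HasAntidiagonal.antidiagonal n,
      (p.2.choose p.1 : ℝ) * ((t - 1) * (α * β)) ^ p.1 * stairProd α β p.2 x := by
  induction n using Nat.twoStepInduction generalizing x with
  | zero => simp [stairGen_zero, stairProd]
  | one => simp [stairGen_one, Finset.Nat.antidiagonal_succ, stairProd]
  | more n ih ih' =>
    rw [stairGen_succ_succ, ih, ih', Finset.Nat.sum_antidiagonal_succ' (n := n + 1),
      Finset.Nat.sum_antidiagonal_succ (n := n), Finset.Nat.sum_antidiagonal_succ (n := n)]
    simp only [mul_add, Finset.mul_sum, add_assoc, ← Finset.sum_add_distrib]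
    simp only [stairProd_succ, Nat.choose_succ_succ, Nat.choose_zero_right]
    push_cast
    rw [Nat.choose_eq_zero_of_lt (Nat.succ_pos (n + 1)), Nat.cast_zero, zero_mul, zero_mul,
      zero_add, stairProd_succ α β (n + 1) x, stairProd_succ α β n (x + β)]
    congr 1
    · ring
    · refine Finset.sum_congr rfl fun p _ => ?_
      ring

lemma stairZ_eq (n : ℕ) (α β : ℝ) : stairZ n α β = stairProd α β n 1 := by
  have h : stairZ n α β = stairGen α β 1 n 1 := by simp [stairZ, stairGen]
  rw [h, stairGen_eq, Finset.sum_eq_single (0, n)]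
  · simp
  · rintro ⟨r, m⟩ hp hne
    rw [Finset.HasAntidiagonal.mem_antidiagonal] at hp
    have hr : r ≠ 0 := by
      rintro rfl
      exact hne (by simpa using hp)
    simp [hr]
  · simp

lemma finsum_stairX_eq (α β : ℝ) (n k : ℕ) :
    ∑ᶠ S ∈ {S | IsStaircase n S ∧ stairX n S = k}, stairWt α β S =
      ∑ p ∈ Finset.HasAntidiagonal.antidiagonal n,
        (p.2.choose p.1 : ℝ) * (α * β) ^ p.1 * stairProd α β p.2 1 *
        ((-1) ^ (p.1 - k) * (p.1.choose k : ℝ)) := by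
  have hpoly : ∑ S ∈ (finite_isStaircase n).toFinset,
        Polynomial.C (stairWt α β S) * Polynomial.X ^ stairX n S =
      ∑ p ∈ Finset.HasAntidiagonal.antidiagonal n,
        Polynomial.C ((p.2.choose p.1 : ℝ) * (α * β) ^ p.1 * stairProd α β p.2 1) *
          (Polynomial.X + Polynomial.C (-1)) ^ p.1 := by
    refine Polynomial.funext fun t => ?_
    have h := stairGen_eq α β t n 1
    rw [stairGen, finsum_mem_eq_finite_toFinset_sum _ (finite_isStaircase n)] at h
    simp only [Polynomial.eval_finsetSum, Polynomial.eval_mul, Polynomial.eval_C,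
      Polynomial.eval_pow, Polynomial.eval_X, Polynomial.eval_add]
    simp only [one_pow, mul_one] at h
    rw [h]
    refine Finset.sum_congr rfl fun p _ => ?_
    rw [mul_pow]
    ring
  have hcoeff := congrArg (fun q => Polynomial.coeff q k) hpoly
  simp only [Polynomial.finsetSum_coeff, Polynomial.coeff_C_mul, Polynomial.coeff_X_pow,
    Polynomial.coeff_X_add_C_pow] at hcoeff
  rw [← hcoeff, finsum_mem_eq_finite_toFinset_sum _
    ((finite_isStaircase n).subset fun S hS => hS.1)]
  simp only [mul_ite, mul_one, mul_zero]
  rw [← Finset.sum_filter]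
  refine Finset.sum_congr ?_ fun _ _ => rfl
  ext S
  simp [eq_comm]

/-- The normalized `r`-th factorial moment of the number of nonempty boxes on the second main
diagonal, as a function of `m = n - r` and `c = α⁻¹ + β⁻¹`. -/
noncomputable def momentRatio (c : ℝ) (m r : ℕ) : ℝ :=
  ∏ i ∈ Finset.range r, ((m - i : ℕ) : ℝ) / (c + m + i)

lemma momentRatio_nonneg {c : ℝ} (hc : 0 < c) (m r : ℕ) : 0 ≤ momentRatio c m r :=
  Finset.prod_nonneg fun _ _ => by positivity

lemma momentRatio_le_one {c : ℝ} (hc : 0 < c) (m r : ℕ) : momentRatio c m r ≤ 1 := by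
  refine Finset.prod_le_one (fun _ _ => by positivity) fun i _ => ?_
  rw [div_le_one (by positivity)]
  have h : ((m - i : ℕ) : ℝ) ≤ m := by exact_mod_cast Nat.sub_le m i
  have : (0 : ℝ) ≤ i := by positivity
  linarith

lemma momentRatio_zero_left (c : ℝ) {r : ℕ} (hr : r ≠ 0) : momentRatio c 0 r = 0 :=
  Finset.prod_eq_zero (Finset.mem_range.2 (Nat.pos_of_ne_zero hr)) (by simp)

lemma tendsto_momentRatio {c : ℝ} (hc : 0 < c) (r : ℕ) :
    Filter.Tendsto (fun m => momentRatio c m r) Filter.atTop (nhds 1) := by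
  have h : ∀ i ∈ Finset.range r, Filter.Tendsto
      (fun m : ℕ => ((m - i : ℕ) : ℝ) / (c + m + i)) Filter.atTop (nhds 1) := by
    intro i _
    have h1 : Filter.Tendsto (fun m : ℕ => 1 - (c + 2 * i) / ((m : ℝ) + (c + i)))
        Filter.atTop (nhds (1 - 0)) := by
      refine tendsto_const_nhds.sub (Filter.Tendsto.const_div_atTop ?_ _)
      exact Filter.tendsto_atTop_add_const_right _ _ tendsto_natCast_atTop_atTop
    rw [sub_zero] at h1
    refine h1.congr' ?_
    filter_upwards [Filter.eventually_ge_atTop i] with m hm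
    rw [Nat.cast_sub hm]
    have : c + m + i ≠ 0 := by positivity
    have : (m : ℝ) + (c + i) ≠ 0 := by positivity
    field_simp
    ring
  simpa [momentRatio] using tendsto_finsetProd (Finset.range r) h

lemma choose_mul_stairProd {α β : ℝ} (hα : 0 < α) (hβ : 0 < β) (m r : ℕ) :
    (m.choose r : ℝ) * (α * β) ^ r * stairProd α β m 1 =
      momentRatio (α⁻¹ + β⁻¹) m r / r.factorial * stairProd α β (r + m) 1 := by
  have h1 : stairProd α β (r + m) 1 = stairProd α β m 1 *
      ((α * β) ^ r * ∏ i ∈ Finset.range r, (α⁻¹ + β⁻¹ + m + i)) := by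
    rw [add_comm r m, stairProd, Finset.prod_range_add, stairProd]
    congr 1
    rw [← Finset.card_range r, ← Finset.prod_const, Finset.card_range, ← Finset.prod_mul_distrib]
    refine Finset.prod_congr rfl fun i _ => ?_
    push_cast
    field_simp
    ring
  have h2 : (r.factorial : ℝ) * (m.choose r : ℝ) =
      momentRatio (α⁻¹ + β⁻¹) m r * ∏ i ∈ Finset.range r, (α⁻¹ + β⁻¹ + m + i) := by
    rw [momentRatio, ← Finset.prod_mul_distrib, ← Nat.cast_mul,
      ← Nat.descFactorial_eq_factorial_mul_choose, Nat.descFactorial_eq_prod_range, Nat.cast_prod]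
    refine Finset.prod_congr rfl fun i _ => ?_
    rw [div_mul_cancel₀]
    positivity
  have hr : (r.factorial : ℝ) ≠ 0 := by positivity
  rw [h1]
  rw [div_mul_eq_mul_div, eq_div_iff hr]
  linear_combination (α * β) ^ r * stairProd α β m 1 * h2

lemma stairProd_pos {α β : ℝ} (hα : 0 < α) (hβ : 0 < β) (n : ℕ) : 0 < stairProd α β n 1 :=
  Finset.prod_pos fun _ _ => by positivity

lemma stairP_stairX_eq {α β : ℝ} (hα : 0 < α) (hβ : 0 < β) (n k : ℕ) :
    stairP n α β (fun S => stairX n S = k) =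
      ∑' r : ℕ, momentRatio (α⁻¹ + β⁻¹) (n - r) r / r.factorial *
        ((-1) ^ (r - k) * (r.choose k : ℝ)) := by
  rw [tsum_eq_sum (s := Finset.range (n + 1)), stairP, finsum_stairX_eq, stairZ_eq,
    div_eq_iff (stairProd_pos hα hβ n).ne', Finset.Nat.sum_antidiagonal_eq_sum_range_succ_mk,
    Finset.sum_mul]
  · refine Finset.sum_congr rfl fun r hr => ?_
    rw [choose_mul_stairProd hα hβ,
      Nat.add_sub_cancel' (Nat.lt_succ_iff.1 (Finset.mem_range.1 hr))]
    ring
  · intro r hr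
    rw [Finset.mem_range] at hr
    rw [Nat.sub_eq_zero_of_le (by omega), momentRatio_zero_left _ (by omega), zero_div, zero_mul]

lemma choose_div_factorial (s k : ℕ) :
    ((s + k).choose k : ℝ) / (s + k).factorial = 1 / s.factorial / k.factorial := by
  rw [← Nat.add_choose_mul_factorial_mul_factorial s k]
  have : ((s + k).choose k : ℝ) ≠ 0 := by
    exact_mod_cast (Nat.choose_pos (Nat.le_add_left k s)).ne'
  push_cast
  field_simp

lemma hasSum_choose_div_factorial (x : ℝ) (k : ℕ) :
    HasSum (fun r : ℕ => x ^ (r - k) * ((r.choose k : ℝ) / r.factorial))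
      (Real.exp x / k.factorial) := by
  have h : HasSum (fun s : ℕ => x ^ s / s.factorial) (Real.exp x) := by
    rw [Real.exp_eq_exp_ℝ]
    exact NormedSpace.expSeries_div_hasSum_exp x
  have h0 : ∑ r ∈ Finset.range k, x ^ (r - k) * ((r.choose k : ℝ) / r.factorial) = 0 :=
    Finset.sum_eq_zero fun r hr => by simp [Nat.choose_eq_zero_of_lt (Finset.mem_range.1 hr)]
  rw [← add_zero (Real.exp x / k.factorial), ← h0, ← hasSum_nat_add_iff k]
  refine (h.div_const _).congr_fun fun s => ?_
  rw [choose_div_factorial, Nat.add_sub_cancel]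
  ring

/-- The number `X_n` of nonempty boxes on the second main diagonal converges in
distribution to `Pois(1)`. -/
theorem nonempty_second_diagonal_poisson
    (α β : ℝ) (hα : 0 < α) (hβ : 0 < β) (k : ℕ) :
    Filter.Tendsto (fun n : ℕ =>
        stairP n α β (fun S =>
          (((Finset.Icc 1 (n - 1)).filter
            (fun j => S (n - j) j ≠ StairSymb.empty)).card) = k))
      Filter.atTop
      (nhds (Real.exp (-1 : ℝ) / (Nat.factorial k : ℝ))) := by
  change Filter.Tendsto (fun n => stairP n α β fun S => stairX n S = k) _ _
  have hc : 0 < α⁻¹ + β⁻¹ := by positivity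
  simp only [stairP_stairX_eq hα hβ]
  rw [← (hasSum_choose_div_factorial (-1) k).tsum_eq]
  refine tendsto_tsum_of_dominated_convergence
    (bound := fun r : ℕ => (1 : ℝ) ^ (r - k) * ((r.choose k : ℝ) / r.factorial))
    (hasSum_choose_div_factorial 1 k).summable (fun r => ?_) (Filter.Eventually.of_forall ?_)
  · have h : Filter.Tendsto (fun n => momentRatio (α⁻¹ + β⁻¹) (n - r) r) Filter.atTop (nhds 1) :=
      (tendsto_momentRatio hc r).comp (Filter.tendsto_sub_atTop_nat r)
    have hlim : (-1 : ℝ) ^ (r - k) * ((r.choose k : ℝ) / r.factorial) =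
        1 / r.factorial * ((-1) ^ (r - k) * (r.choose k : ℝ)) := by ring
    rw [hlim]
    exact (h.div_const _).mul_const _
  · intro n r
    rw [norm_mul, norm_mul, norm_pow, norm_neg, norm_one, Real.norm_natCast,
      Real.norm_of_nonneg (div_nonneg (momentRatio_nonneg hc _ _) (Nat.cast_nonneg _)),
      one_pow, one_mul, one_mul, div_mul_eq_mul_div]
    gcongr
    exact mul_le_of_le_one_left (Nat.cast_nonneg _) (momentRatio_le_one hc _ _)
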